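/- Let g be a transcendental entire function with g(0) = 1, and let δ > 0 and m > 1. Then there exist a constant C > 0 and a set F ⊂ [0,∞) with dens̄(F) < δ such that log|g(z)| ≥ −C(1 + log(1/δ)) · L(r,∞,g) · log^m L(r,∞,g) for all z with |z| = r ∉ F. -/

import Mathlib

open MeasureTheory Filter Metric

noncomputable section

/-- `log⁺ x = max (log x) 0`. -/
def logPlus (x : ℝ) : ℝ := max (Real.log x) 0

/-- The point `r·e^{iθ}` on the circle of radius `r`. -/
def circlePt (r θ : ℝ) : ℂ := (r : ℂ) * Complex.exp (θ * Complex.I)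

/-- Maximum modulus `M(r,g)`. -/
def maxMod (g : ℂ → ℂ) (r : ℝ) : ℝ := sSup ((fun z => ‖g z‖) '' sphere (0:ℂ) r)

/-- `L(r,a,f) = max_{|z|=r} log⁺ (1/|f z − a|)`. -/
def Lfin (f : ℂ → ℂ) (a : ℂ) (r : ℝ) : ℝ :=
  sSup ((fun z => logPlus (1 / ‖f z - a‖)) '' sphere (0:ℂ) r)

/-- `L(r,∞,f) = max_{|z|=r} log⁺ |f z|`. -/
def Linf (f : ℂ → ℂ) (r : ℝ) : ℝ :=
  sSup ((fun z => logPlus ‖f z‖) '' sphere (0:ℂ) r)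

/-- Nevanlinna proximity function `m(r,a,f)`. -/
def proximity (f : ℂ → ℂ) (a : ℂ) (r : ℝ) : ℝ :=
  (1 / (2 * Real.pi)) * ∫ θ in (0:ℝ)..(2 * Real.pi), logPlus (1 / ‖f (circlePt r θ) - a‖)

/-- Spherical derivative `f#`. -/
def sphDeriv (f : ℂ → ℂ) (z : ℂ) : ℝ := ‖deriv f z‖ / (1 + ‖f z‖ ^ 2)

/-- `A(r,f)`, the normalized spherical area of the image of `D(0,r)`. -/
def sphArea (f : ℂ → ℂ) (r : ℝ) : ℝ :=
  (1 / Real.pi) * ∫ z in ball (0:ℂ) r, sphDeriv f z ^ 2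

/-- Ahlfors–Shimizu characteristic `T₀(r,f)`. -/
def T0 (f : ℂ → ℂ) (r : ℝ) : ℝ := ∫ t in (0:ℝ)..r, sphArea f t / t

/-- The Nevanlinna characteristic `T(r,f)`; we use the Ahlfors–Shimizu characteristic,
which agrees with the classical Nevanlinna characteristic up to a bounded term. -/
def nevT (f : ℂ → ℂ) (r : ℝ) : ℝ := T0 f r

/-- Petrenko's magnitude of deviation `δ_P(a,f)`. -/
def deltaP (f : ℂ → ℂ) (a : ℂ) : ℝ := liminf (fun r => Lfin f a r / nevT f r) atTop

/-- Nevanlinna deficiency `δ_N(a,f)`. -/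
def deltaN (f : ℂ → ℂ) (a : ℂ) : ℝ := liminf (fun r => proximity f a r / nevT f r) atTop

/-- Eremenko deviation `δ_E(a,f)`. -/
def deltaE (f : ℂ → ℂ) (a : ℂ) : ℝ := liminf (fun r => Lfin f a r / sphArea f r) atTop

/-- Order of growth `ρ(f)` (as an extended real, via the characteristic). -/
def fnOrder (f : ℂ → ℂ) : EReal :=
  limsup (fun r => ((Real.log (nevT f r) / Real.log r : ℝ) : EReal)) atTop

/-- Logarithmic order `ρ_log(f)`. -/
def fnLogOrder (f : ℂ → ℂ) : EReal :=
  limsup (fun r => ((Real.log (nevT f r) / Real.log (Real.log r) : ℝ) : EReal)) atTop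

/-- Upper linear density of `E ⊆ [0,∞)`. -/
def upDens (E : Set ℝ) : ℝ :=
  limsup (fun r => (volume (E ∩ Set.Icc 0 r)).toReal / r) atTop

/-- Upper logarithmic density of `E ⊆ [1,∞)`. -/
def upLogDens (E : Set ℝ) : ℝ :=
  limsup (fun r => (∫ t in E ∩ Set.Icc 1 r, 1 / t) / Real.log r) atTop

/-- Finite linear (Lebesgue) measure. -/
def FiniteLinearMeasure (E : Set ℝ) : Prop := volume E < ⊤

/-- Finite logarithmic measure: `∫_E dt/t < ∞`. -/
def FiniteLogMeasure (E : Set ℝ) : Prop := ∫⁻ t in E, ENNReal.ofReal (1 / t) < ⊤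

/-- `g` is (the function of) a polynomial. -/
def IsPolyFn (g : ℂ → ℂ) : Prop := ∃ p : Polynomial ℂ, ∀ z, g z = p.eval z

/-- `g` is a rational function. -/
def IsRatFn (g : ℂ → ℂ) : Prop :=
  ∃ p q : Polynomial ℂ, q ≠ 0 ∧ ∀ z, q.eval z ≠ 0 → g z = p.eval z / q.eval z

/-- Transcendental entire function. -/
def TranscEntire (g : ℂ → ℂ) : Prop := Differentiable ℂ g ∧ ¬ IsPolyFn g

/-- Transcendental meromorphic function on ℂ. -/
def TranscMero (g : ℂ → ℂ) : Prop := MeromorphicOn g Set.univ ∧ ¬ IsRatFn g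

/-- Entire solution of `f⁽ⁿ⁾ + A_{n-1} f⁽ⁿ⁻¹⁾ + ⋯ + A₀ f = 0`. -/
def IsSolutionE (n : ℕ) (A : Fin n → ℂ → ℂ) (f : ℂ → ℂ) : Prop :=
  Differentiable ℂ f ∧
  ∀ z, iteratedDeriv n f z + ∑ j : Fin n, A j z * iteratedDeriv j f z = 0

/-- Meromorphic solution of the equation (the identity is required at every point where
all functions involved are analytic, which determines it as an identity of meromorphic
functions). -/
def IsSolutionM (n : ℕ) (A : Fin n → ℂ → ℂ) (f : ℂ → ℂ) : Prop :=
  MeromorphicOn f Set.univ ∧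
  ∀ z, AnalyticAt ℂ f z → (∀ j, AnalyticAt ℂ (A j) z) →
    iteratedDeriv n f z + ∑ j : Fin n, A j z * iteratedDeriv j f z = 0

/-- A solution base of the equation with entire coefficients. -/
def IsSolutionBase (n : ℕ) (A : Fin n → ℂ → ℂ) (F : Fin n → ℂ → ℂ) : Prop :=
  (∀ k, IsSolutionE n A (F k)) ∧ LinearIndependent ℂ F ∧
  ∀ g, IsSolutionE n A g → ∃ c : Fin n → ℂ, g = fun z => ∑ k : Fin n, c k * F k z

/-- The characteristic function `T(r)` of the equation attached to a solution base. -/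
def charFn (n : ℕ) (F : Fin n → ℂ → ℂ) (r : ℝ) : ℝ :=
  (1 / (2 * Real.pi)) * ∫ θ in (0:ℝ)..(2 * Real.pi),
    Real.log (Real.sqrt (1 + ∑ k : Fin n, ‖F k (circlePt r θ)‖ ^ 2))

/-- Multiplicity of `z` as a zero of `g` (smallest `k` with `g⁽ᵏ⁾(z) ≠ 0`). -/
def zeroMult (g : ℂ → ℂ) (z : ℂ) : ℕ := sInf {k : ℕ | iteratedDeriv k g z ≠ 0}

/-- Number of zeros of `g` in `|z| ≤ r`, counted with multiplicity. -/
def zeroCount (g : ℂ → ℂ) (r : ℝ) : ℕ := ∑ᶠ z ∈ closedBall (0:ℂ) r, zeroMult g z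

end
theorem logPlus_le_Linf {g : ℂ → ℂ} (hg : Continuous g) (z : ℂ) :
    logPlus ‖g z‖ ≤ Linf g ‖z‖ := by
  refine le_csSup ?_ ⟨z, by simp, rfl⟩
  obtain ⟨M, hM⟩ := (isCompact_sphere (0 : ℂ) ‖z‖).exists_bound_of_continuousOn hg.continuousOn
  refine ⟨logPlus M, ?_⟩
  rintro _ ⟨w, hw, rfl⟩
  rcases (norm_nonneg (g w)).eq_or_lt with h | h
  · simp [logPlus, ← h]
  · exact max_le_max (Real.log_le_log h (hM w hw)) le_rfl

theorem Linf_nonneg (g : ℂ → ℂ) (r : ℝ) : 0 ≤ Linf g r :=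
  Real.sSup_nonneg (by rintro _ ⟨w, -, rfl⟩; exact le_max_right _ _)

theorem le_exp_logPlus (x : ℝ) : x ≤ Real.exp (logPlus x) :=
  (Real.le_exp_log x).trans (Real.exp_le_exp.2 (le_max_left _ _))

/-- A bound on a circle extends to the closed disc. -/
theorem norm_le_of_sphere {f : ℂ → ℂ} (hf : Differentiable ℂ f) {r C : ℝ}
    (hC : ∀ z, ‖z‖ = r → ‖f z‖ ≤ C) {z : ℂ} (hz : ‖z‖ ≤ r) : ‖f z‖ ≤ C := by
  rcases hz.eq_or_lt with h | h
  · exact hC z h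
  have hr : r ≠ 0 := ((norm_nonneg z).trans_lt h).ne'
  refine Complex.norm_le_of_forall_mem_frontier_norm_le (isBounded_ball (x := (0 : ℂ)) (r := r))
    hf.diffContOnCl (fun w hw => hC w ?_) (subset_closure (by simpa using h))
  rw [frontier_ball _ hr] at hw
  simpa using hw

theorem norm_le_exp_Linf {g : ℂ → ℂ} (hg : Differentiable ℂ g) {r : ℝ} {z : ℂ} (hz : ‖z‖ ≤ r) :
    ‖g z‖ ≤ Real.exp (Linf g r) := by
  refine norm_le_of_sphere hg (fun w hw => ?_) hz
  subst hw
  exact (le_exp_logPlus _).trans (Real.exp_le_exp.2 (logPlus_le_Linf hg.continuous w))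

theorem Linf_mono {g : ℂ → ℂ} (hg : Differentiable ℂ g) {r R : ℝ} (h : r ≤ R) :
    Linf g r ≤ Linf g R := by
  refine Real.sSup_le ?_ (Linf_nonneg g R)
  rintro _ ⟨w, hw, rfl⟩
  have hw' : ‖w‖ = r := by simpa using hw
  refine max_le ?_ (Linf_nonneg g R)
  by_cases h0 : g w = 0
  · simpa [h0] using Linf_nonneg g R
  · exact (Real.log_le_iff_le_exp (norm_pos_iff.2 h0)).2
      (norm_le_exp_Linf hg (hw'.le.trans h))

theorem tendsto_Linf_atTop {g : ℂ → ℂ} (hg : TranscEntire g) : Tendsto (Linf g) atTop atTop := by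
  refine tendsto_atTop_atTop.2 fun b => ?_
  by_contra! hcon
  refine hg.2 ⟨Polynomial.C (g 0), fun z => ?_⟩
  rw [Polynomial.eval_C]
  refine hg.1.apply_eq_apply_of_bounded (isBounded_iff_forall_norm_le.2 ⟨Real.exp b, ?_⟩) z 0
  rintro _ ⟨w, rfl⟩
  obtain ⟨a, ha, hab⟩ := hcon ‖w‖
  exact (norm_le_exp_Linf hg.1 ha).trans (Real.exp_le_exp.2 hab.le)

open scoped ComplexConjugate in
/-- Reflecting finitely many zeros of `g` in the circle of radius `R` does not change the modulus
on that circle. -/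
theorem norm_reflect_zeros_le {g h : ℂ → ℂ} (hg : Differentiable ℂ g) (hh : Differentiable ℂ h)
    {n : ℕ} {a : Fin n → ℂ} (hfac : ∀ z, g z = (∏ i, (z - a i)) * h z) {R : ℝ} (hR : 0 < R)
    {z : ℂ} (hz : ‖z‖ ≤ R) :
    ‖(∏ i, ((R : ℂ) ^ 2 - conj (a i) * z) / R) * h z‖ ≤ Real.exp (Linf g R) := by
  refine norm_le_of_sphere (f := fun z => (∏ i, ((R : ℂ) ^ 2 - conj (a i) * z) / R) * h z)
    ?_ (fun w hw => ?_) hz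
  · fun_prop
  · refine le_of_eq_of_le ?_ (norm_le_exp_Linf hg hw.le)
    rw [hfac w, norm_mul, norm_mul, norm_prod, norm_prod]
    congr 1
    refine Finset.prod_congr rfl fun i _ => ?_
    have hsq : (R : ℂ) ^ 2 = conj w * w := by
      rw [← hw, Complex.conj_mul']
    rw [hsq, ← sub_mul, ← map_sub, norm_div, norm_mul, Complex.norm_conj, Complex.norm_real,
      Real.norm_of_nonneg hR.le, hw, mul_div_cancel_right₀ _ hR.ne']

/-- A form of Jensen's inequality for finitely many zeros. -/
theorem sum_log_div_le_Linf {g h : ℂ → ℂ} (hg : Differentiable ℂ g) (hh : Differentiable ℂ h)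
    (h0 : g 0 = 1) {n : ℕ} {a : Fin n → ℂ} (hfac : ∀ z, g z = (∏ i, (z - a i)) * h z)
    {R : ℝ} (hR : 0 < R) :
    ∑ i, Real.log (R / ‖a i‖) ≤ Linf g R := by
  have h1 := norm_reflect_zeros_le hg hh hfac hR (z := 0) (by simpa using hR.le)
  have h2 := congrArg norm (hfac 0)
  rw [h0] at h2
  simp only [norm_one, norm_mul, norm_prod, zero_sub, norm_neg] at h2
  have ha : ∀ i, ‖a i‖ ≠ 0 := fun i hi => by
    rw [Finset.prod_eq_zero (Finset.mem_univ i) hi] at h2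
    simp at h2
  have hP : (∏ i, ‖a i‖) ≠ 0 := Finset.prod_ne_zero_iff.2 fun i _ => ha i
  rw [← Real.log_prod fun i _ => div_ne_zero hR.ne' (ha i),
    Real.log_le_iff_le_exp (Finset.prod_pos fun i _ =>
      div_pos hR ((norm_nonneg _).lt_of_ne' (ha i)))]
  refine le_of_eq_of_le ?_ h1
  rw [norm_mul, norm_prod]
  have h3 : ‖h 0‖ = (∏ i, ‖a i‖)⁻¹ := by
    exact eq_inv_of_mul_eq_one_right h2.symm
  rw [h3, Finset.prod_div_distrib, div_eq_mul_inv]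
  congr 1
  refine Finset.prod_congr rfl fun i _ => ?_
  simp only [mul_zero, sub_zero, norm_div, norm_pow, Complex.norm_real,
    Real.norm_of_nonneg hR.le]
  field_simp

theorem card_zeros_mul_log_le_Linf {g h : ℂ → ℂ} (hg : Differentiable ℂ g)
    (hh : Differentiable ℂ h) (h0 : g 0 = 1) {n : ℕ} {a : Fin n → ℂ}
    (hfac : ∀ z, g z = (∏ i, (z - a i)) * h z) {r R : ℝ} (hR : 0 < R)
    (ha0 : ∀ i, a i ≠ 0) (ha : ∀ i, ‖a i‖ < r) :
    n * Real.log (R / r) ≤ Linf g R := by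
  refine le_trans ?_ (sum_log_div_le_Linf hg hh h0 hfac hR)
  have : (n : ℝ) * Real.log (R / r) = ∑ _i : Fin n, Real.log (R / r) := by simp
  rw [this]
  refine Finset.sum_le_sum fun i _ => ?_
  have := norm_pos_iff.2 (ha0 i)
  have := ha i
  have : 0 < r := by linarith
  gcongr

/-- Splitting off the zeros of an entire function in a disc. -/
theorem exists_factor_zeros {g : ℂ → ℂ} (hg : Differentiable ℂ g) (h0 : g 0 = 1) {r : ℝ}
    (hr : 0 < r) :
    ∃ (n : ℕ) (a : Fin n → ℂ) (h : ℂ → ℂ), Differentiable ℂ h ∧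
      (∀ z, g z = (∏ i, (z - a i)) * h z) ∧ (∀ i, a i ≠ 0) ∧ (∀ i, ‖a i‖ < r) ∧
      ∀ z, ‖z‖ < r → h z ≠ 0 := by
  by_contra! hcon
  have key : ∀ n : ℕ, ∃ (a : Fin n → ℂ) (h : ℂ → ℂ), Differentiable ℂ h ∧
      (∀ z, g z = (∏ i, (z - a i)) * h z) ∧ (∀ i, a i ≠ 0) ∧ (∀ i, ‖a i‖ < r) := by
    intro n
    induction n with
    | zero => exact ⟨Fin.elim0, g, hg, by simp, fun i => i.elim0, fun i => i.elim0⟩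
    | succ n ih =>
      obtain ⟨a, h, hh, hfac, ha0, ha⟩ := ih
      obtain ⟨b, hb, hb0⟩ := hcon n a h hh hfac ha0 ha
      refine ⟨Fin.cons b a, dslope h b, ?_, fun z => ?_, fun i => ?_, fun i => ?_⟩
      · exact differentiableOn_univ.1
          ((Complex.differentiableOn_dslope univ_mem).2 hh.differentiableOn)
      · have := sub_smul_dslope h b z
        rw [hb0, sub_zero, smul_eq_mul] at this
        rw [hfac z, ← this, Fin.prod_univ_succ]
        simp only [Fin.cons_zero, Fin.cons_succ]
        ring
      · refine Fin.cases ?_ (fun j => ?_) i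
        · rintro rfl
          rw [hfac 0, hb0, mul_zero] at h0
          exact zero_ne_one h0
        · simpa using ha0 j
      · refine Fin.cases ?_ (fun j => ?_) i
        · simpa using hb
        · simpa using ha j
  obtain ⟨n, hn⟩ := exists_nat_gt (Linf g (2 * r) / Real.log (2 * r / r))
  obtain ⟨a, h, hh, hfac, ha0, ha⟩ := key n
  have hlog : 0 < Real.log (2 * r / r) := Real.log_pos (by rw [lt_div_iff₀ hr]; linarith)
  have := card_zeros_mul_log_le_Linf hg hh h0 hfac (R := 2 * r) (by linarith) ha0 ha
  rw [div_lt_iff₀ hlog] at hn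
  linarith

theorem exists_log_on_ball {f : ℂ → ℂ} {R : ℝ} (hR : 0 < R) (hf : Differentiable ℂ f)
    (hne : ∀ z, ‖z‖ < R → f z ≠ 0) :
    ∃ G : ℂ → ℂ, DifferentiableOn ℂ G (ball 0 R) ∧
      ∀ z ∈ ball (0 : ℂ) R, Complex.exp (G z) = f z := by
  have hne' : ∀ z ∈ ball (0 : ℂ) R, f z ≠ 0 := fun z hz => hne z (by simpa using hz)
  have hdf : Differentiable ℂ (deriv f) := hf.contDiff.differentiable_deriv_two
  have hd : DifferentiableOn ℂ (fun z => deriv f z / f z) (ball 0 R) :=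
    hdf.differentiableOn.div hf.differentiableOn hne'
  obtain ⟨G, hG0, hG⟩ := hd.isExactOn_ball.with_val_at 0 (Complex.log (f 0))
  refine ⟨G, fun z hz => (hG z hz).differentiableAt.differentiableWithinAt, fun z hz => ?_⟩
  have hderiv : ∀ w ∈ ball (0 : ℂ) R,
      HasDerivAt (fun z => f z * Complex.exp (-G z)) 0 w := by
    intro w hw
    refine ((hf w).hasDerivAt.mul (hG w hw).neg.cexp).congr_deriv ?_
    have := hne' w hw
    field_simp
    ring
  have h0 : (0 : ℂ) ∈ ball (0 : ℂ) R := mem_ball_self hR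
  have := (convex_ball (0 : ℂ) R).is_const_of_fderivWithin_eq_zero (𝕜 := ℂ)
    (f := fun z => f z * Complex.exp (-G z))
    (fun w hw => (hderiv w hw).differentiableAt.differentiableWithinAt)
    (fun w hw => by
      rw [(hderiv w hw).hasFDerivAt.hasFDerivWithinAt.fderivWithin
        (isOpen_ball.uniqueDiffWithinAt hw)]
      ext; simp) hz h0
  simp only [hG0, Complex.exp_neg, Complex.exp_log (hne' 0 h0)] at this
  rw [mul_inv_cancel₀ (hne' 0 h0), mul_inv_eq_one₀ (Complex.exp_ne_zero _)] at this
  exact this.symm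

/-- A consequence of Harnack's inequality for zero-free bounded functions. -/
theorem le_log_norm_of_ne_zero {f : ℂ → ℂ} {R L : ℝ} (hL : 0 < L) (hf : Differentiable ℂ f)
    (hne : ∀ z, ‖z‖ < R → f z ≠ 0) (hb : ∀ z, ‖z‖ < R → ‖f z‖ ≤ Real.exp L)
    (h0 : 1 ≤ ‖f 0‖) {z : ℂ} (hz : ‖z‖ < R) :
    -(2 * L * ‖z‖ / (R - ‖z‖)) ≤ Real.log ‖f z‖ := by
  have hR : 0 < R := (norm_nonneg z).trans_lt hz
  have hd : 0 < R - ‖z‖ := by linarith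
  obtain ⟨G, hG, hexp⟩ := exists_log_on_ball hR hf hne
  have hre : ∀ w, ‖w‖ < R → (G w).re = Real.log ‖f w‖ := fun w hw => by
    rw [← hexp w (by simpa using hw), Complex.norm_exp, Real.log_exp]
  have hre0 : 0 ≤ (G 0).re := by
    rw [hre 0 (by simpa using hR)]; exact Real.log_nonneg h0
  have := Complex.borelCaratheodory_zero (f := fun w => G w - G 0) (M := L) (R := R) (z := z)
    hL (by fun_prop) (fun w hw => ?_) hR (by simpa using hz) (by simp)
  · have h1 := (neg_le_abs (G z - G 0).re).trans (Complex.abs_re_le_norm (G z - G 0))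
    rw [Complex.sub_re] at h1
    rw [← hre z hz]
    linarith
  · have hw' : ‖w‖ < R := by simpa using hw
    have : (G w).re ≤ L := by
      rw [hre w hw']
      exact (Real.log_le_iff_le_exp (norm_pos_iff.2 (hne w hw'))).2 (hb w hw')
    simp only [Set.mem_ofPred_eq, Complex.sub_re]
    linarith

/-- Lower bound for an entire function in terms of its maximum modulus and the moduli of its
zeros. -/
theorem le_log_norm_of_zeros {g h : ℂ → ℂ} (hg : Differentiable ℂ g) (hh : Differentiable ℂ h)
    (h0 : g 0 = 1) {n : ℕ} {a : Fin n → ℂ} (hfac : ∀ z, g z = (∏ i, (z - a i)) * h z)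
    (ha0 : ∀ i, a i ≠ 0) {r R E : ℝ} (ha : ∀ i, ‖a i‖ < r) (hrR : r ≤ R)
    (hne : ∀ z, ‖z‖ < r → h z ≠ 0) (hE : 0 < E) (hgE : Linf g R ≤ E) {z : ℂ} (hz : ‖z‖ < r)
    (hza : ∀ i, ‖z‖ ≠ ‖a i‖) :
    -(2 * E * ‖z‖ / (r - ‖z‖) + E + n * Real.log 2 - ∑ i, Real.log |1 - ‖z‖ / ‖a i‖|)
      ≤ Real.log ‖g z‖ := by
  have hr : 0 < r := (norm_nonneg z).trans_lt hz
  have hR : 0 < R := hr.trans_le hrR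
  have haR : ∀ i, ‖a i‖ < R := fun i => (ha i).trans_le hrR
  have hapos : ∀ i, 0 < ‖a i‖ := fun i => norm_pos_iff.2 (ha0 i)
  have hnum : ∀ w : ℂ, ‖w‖ < r → ∀ i, (R : ℂ) ^ 2 - (starRingEnd ℂ) (a i) * w ≠ 0 := by
    intro w hw i hcon
    have := congrArg norm (sub_eq_zero.1 hcon)
    rw [norm_pow, norm_mul, Complex.norm_conj, Complex.norm_real, Real.norm_of_nonneg hR.le]
      at this
    have h1 : ‖a i‖ * ‖w‖ < R * R :=
      mul_lt_mul'' (haR i) (hw.trans_le hrR) (norm_nonneg _) (norm_nonneg _)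
    nlinarith
  have hRc : (R : ℂ) ≠ 0 := by exact_mod_cast hR.ne'
  set f : ℂ → ℂ := fun z => (∏ i, ((R : ℂ) ^ 2 - (starRingEnd ℂ) (a i) * z) / R) * h z with hf
  have hf0 : 1 ≤ ‖f 0‖ := by
    have h2 := congrArg norm (hfac 0)
    rw [h0] at h2
    simp only [norm_one, norm_mul, norm_prod, zero_sub, norm_neg] at h2
    rw [h2, hf]
    simp only [norm_mul, norm_prod, norm_div, mul_zero, sub_zero, norm_pow, Complex.norm_real,
      Real.norm_of_nonneg hR.le]
    gcongr with i
    rw [sq, mul_div_assoc, div_self hR.ne', mul_one]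
    exact (haR i).le
  have hlogf : -(2 * E * ‖z‖ / (r - ‖z‖)) ≤ Real.log ‖f z‖ := by
    refine le_log_norm_of_ne_zero hE (by fun_prop) (fun w hw => ?_) (fun w hw => ?_) hf0 hz
    · exact mul_ne_zero (Finset.prod_ne_zero_iff.2 fun i _ => div_ne_zero (hnum w hw i) hRc)
        (hne w hw)
    · exact (norm_reflect_zeros_le hg hh hfac hR (hw.le.trans hrR)).trans (Real.exp_le_exp.2 hgE)
  have hzane : ∀ i, ‖z - a i‖ ≠ 0 := fun i hi => by
    rw [norm_eq_zero, sub_eq_zero] at hi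
    exact hza i (by rw [hi])
  have hbne : ∀ i, ‖((R : ℂ) ^ 2 - (starRingEnd ℂ) (a i) * z) / R‖ ≠ 0 := fun i =>
    norm_ne_zero_iff.2 (div_ne_zero (hnum z hz i) hRc)
  have hhne : ‖h z‖ ≠ 0 := norm_ne_zero_iff.2 (hne z hz)
  have e1 : Real.log ‖f z‖ =
      ∑ i, Real.log ‖((R : ℂ) ^ 2 - (starRingEnd ℂ) (a i) * z) / R‖ + Real.log ‖h z‖ := by
    rw [hf, norm_mul, norm_prod, Real.log_mul (Finset.prod_ne_zero_iff.2 fun i _ => hbne i) hhne,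
      Real.log_prod fun i _ => hbne i]
  have e2 : Real.log ‖g z‖ = ∑ i, Real.log ‖z - a i‖ + Real.log ‖h z‖ := by
    rw [hfac, norm_mul, norm_prod, Real.log_mul (Finset.prod_ne_zero_iff.2 fun i _ => hzane i) hhne,
      Real.log_prod fun i _ => hzane i]
  have hterm : ∀ i, Real.log ‖((R : ℂ) ^ 2 - (starRingEnd ℂ) (a i) * z) / R‖ ≤
      Real.log ‖z - a i‖ +
        (Real.log (R / ‖a i‖) + Real.log 2 - Real.log |1 - ‖z‖ / ‖a i‖|) := by
    intro i
    have hu : |1 - ‖z‖ / ‖a i‖| = |‖a i‖ - ‖z‖| / ‖a i‖ := by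
      rw [one_sub_div (hapos i).ne', abs_div, abs_of_pos (hapos i)]
    have hd : 0 < |‖a i‖ - ‖z‖| := abs_pos.2 (sub_ne_zero.2 (hza i).symm)
    have h1 : ‖((R : ℂ) ^ 2 - (starRingEnd ℂ) (a i) * z) / R‖ ≤ 2 * R := by
      rw [norm_div, Complex.norm_real, Real.norm_of_nonneg hR.le, div_le_iff₀ hR]
      refine (norm_sub_le _ _).trans ?_
      rw [norm_pow, norm_mul, Complex.norm_conj, Complex.norm_real, Real.norm_of_nonneg hR.le]
      have h1 : ‖a i‖ * ‖z‖ ≤ R * R :=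
        mul_le_mul (haR i).le (hz.le.trans hrR) (norm_nonneg _) hR.le
      nlinarith
    have h2 : |‖a i‖ - ‖z‖| ≤ ‖z - a i‖ := by
      rw [norm_sub_rev]; exact abs_norm_sub_norm_le _ _
    have h3 := Real.log_le_log ((norm_nonneg _).lt_of_ne' (hbne i)) h1
    have h4 := Real.log_le_log hd h2
    rw [Real.log_mul two_ne_zero hR.ne'] at h3
    rw [hu, Real.log_div hR.ne' (hapos i).ne', Real.log_div hd.ne' (hapos i).ne']
    linarith
  have hsum := Finset.sum_le_sum fun i (_ : i ∈ Finset.univ) => hterm i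
  rw [Finset.sum_add_distrib, Finset.sum_sub_distrib, Finset.sum_add_distrib] at hsum
  have hJ := (sum_log_div_le_Linf hg hh h0 hfac hR).trans hgE
  have hc : ∑ _i : Fin n, Real.log 2 = n * Real.log 2 := by simp
  rw [hc] at hsum
  linarith

/-- Almost everywhere equal to `|1 - t / b| ^ (-1/2)`, as real powers of exponent `-1/2` vanish on
negative numbers. -/
noncomputable def invSqrtDist (b t : ℝ) : ℝ := b ^ (1 / 2 : ℝ) * ((b - t) ^ (-1 / 2 : ℝ) + (t - b) ^ (-1 / 2 : ℝ))

theorem rpow_neg_half_of_neg {x : ℝ} (hx : x < 0) : x ^ (-1 / 2 : ℝ) = 0 := by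
  rw [Real.rpow_def_of_neg hx, show (-1 / 2 : ℝ) * Real.pi = -(Real.pi / 2) by ring,
    Real.cos_neg, Real.cos_pi_div_two, mul_zero]

theorem rpow_half_eq_sqrt (x : ℝ) : x ^ (1 / 2 : ℝ) = Real.sqrt x := (Real.sqrt_eq_rpow x).symm

theorem rpow_neg_half_nonneg (x : ℝ) : 0 ≤ x ^ (-1 / 2 : ℝ) := by
  rcases lt_or_ge x 0 with h | h
  · rw [rpow_neg_half_of_neg h]
  · exact Real.rpow_nonneg h _

theorem invSqrtDist_nonneg {b : ℝ} (hb : 0 ≤ b) (t : ℝ) : 0 ≤ invSqrtDist b t :=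
  mul_nonneg (Real.rpow_nonneg hb _)
    (add_nonneg (rpow_neg_half_nonneg _) (rpow_neg_half_nonneg _))

theorem invSqrtDist_eq {b t : ℝ} (hb : 0 < b) (ht : t ≠ b) :
    invSqrtDist b t = |1 - t / b| ^ (-1 / 2 : ℝ) := by
  have h1 : |1 - t / b| = |b - t| * b⁻¹ := by
    rw [one_sub_div hb.ne', abs_div, abs_of_pos hb, div_eq_mul_inv]
  have h2 : (b - t) ^ (-1 / 2 : ℝ) + (t - b) ^ (-1 / 2 : ℝ) = |b - t| ^ (-1 / 2 : ℝ) := by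
    rcases lt_or_gt_of_ne ht with h | h
    · rw [rpow_neg_half_of_neg (sub_neg.2 h), abs_of_pos (sub_pos.2 h), add_zero]
    · rw [rpow_neg_half_of_neg (sub_neg.2 h), abs_of_neg (sub_neg.2 h), zero_add, neg_sub]
  rw [invSqrtDist, h1, h2, Real.mul_rpow (abs_nonneg _) (inv_nonneg.2 hb.le),
    Real.inv_rpow hb.le, ← Real.rpow_neg hb.le, mul_comm]
  norm_num

theorem intervalIntegrable_invSqrtDist (b x y : ℝ) :
    IntervalIntegrable (invSqrtDist b) volume x y := by
  have h : ∀ c d : ℝ, IntervalIntegrable (fun t : ℝ => t ^ (-1 / 2 : ℝ)) volume c d := fun c d =>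
    intervalIntegral.intervalIntegrable_rpow' (by norm_num)
  refine IntervalIntegrable.const_mul (IntervalIntegrable.add ?_ ?_) _
  · simpa using (h (b - x) (b - y)).comp_sub_left b
  · simpa using (h (x - b) (y - b)).comp_sub_right b

theorem integral_invSqrtDist_le {b x : ℝ} (hb : 0 < b) (hx : 0 ≤ x) :
    ∫ t in (0 : ℝ)..x, invSqrtDist b t ≤ 4 * x := by
  have h : ∀ c d : ℝ, IntervalIntegrable (fun t : ℝ => t ^ (-1 / 2 : ℝ)) volume c d := fun c d =>
    intervalIntegral.intervalIntegrable_rpow' (by norm_num)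
  have hI : ∀ c d : ℝ, ∫ t in c..d, t ^ (-1 / 2 : ℝ) = 2 * (Real.sqrt d - Real.sqrt c) := by
    intro c d
    rw [integral_rpow (Or.inl (by norm_num)), show (-1 / 2 + 1 : ℝ) = 1 / 2 by norm_num,
      rpow_half_eq_sqrt, rpow_half_eq_sqrt]
    ring
  have e1 : ∫ t in (0 : ℝ)..x, (b - t) ^ (-1 / 2 : ℝ) = 2 * (Real.sqrt b - Real.sqrt (b - x)) := by
    rw [intervalIntegral.integral_comp_sub_left (fun t => t ^ (-1 / 2 : ℝ)), hI, sub_zero]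
  have e2 : ∫ t in (0 : ℝ)..x, (t - b) ^ (-1 / 2 : ℝ) = 2 * Real.sqrt (x - b) := by
    rw [intervalIntegral.integral_comp_sub_right (fun t => t ^ (-1 / 2 : ℝ)), hI, zero_sub,
      Real.sqrt_eq_zero_of_nonpos (neg_nonpos.2 hb.le), sub_zero]
  unfold invSqrtDist
  rw [intervalIntegral.integral_const_mul, intervalIntegral.integral_add
    (by simpa using (h b (b - x)).comp_sub_left b)
    (by simpa using (h (-b) (x - b)).comp_sub_right b), e1, e2, rpow_half_eq_sqrt]
  have hbb := Real.mul_self_sqrt hb.le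
  have hs := Real.sqrt_nonneg b
  rcases le_total x b with hxb | hxb
  · have h1 := Real.mul_self_sqrt (sub_nonneg.2 hxb)
    have h2 : Real.sqrt (b - x) ≤ Real.sqrt b := Real.sqrt_le_sqrt (by linarith)
    rw [Real.sqrt_eq_zero_of_nonpos (sub_nonpos.2 hxb)]
    have h3 := Real.sqrt_nonneg (b - x)
    nlinarith
  · have h1 := Real.mul_self_sqrt (sub_nonneg.2 hxb)
    rw [Real.sqrt_eq_zero_of_nonpos (sub_nonpos.2 hxb)]
    nlinarith [sq_nonneg (Real.sqrt b - Real.sqrt (x - b))]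

/-- Outside a set of radii of small density, the sum of `log |1 - t / bᵢ|` is not too small. -/
theorem exists_exceptional_radii {n : ℕ} (b : Fin n → ℝ) (hb : ∀ i, 0 < b i) (l : ℝ) :
    ∃ B : Set ℝ, (∀ x, 0 ≤ x →
        volume (B ∩ Set.Icc 0 x) ≤ ENNReal.ofReal (4 * Real.exp (-(l / 2)) * x)) ∧
      ∀ t, t ∉ B → (∀ i, t ≠ b i) ∧ -(l * n) ≤ ∑ i, Real.log |1 - t / b i| := by
  refine ⟨Set.range b ∪ {t | Real.exp (l / 2) * n < ∑ i, invSqrtDist (b i) t},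
    fun x hx => ?_, fun t ht => ?_⟩
  · have hr : volume (Set.range b) = 0 := (Set.finite_range b).measure_zero _
    rw [Set.union_inter_distrib_right]
    refine (measure_union_le _ _).trans ?_
    rw [measure_mono_null Set.inter_subset_left hr, zero_add]
    rcases Nat.eq_zero_or_pos n with rfl | hn
    · simp
    have hn' : (0 : ℝ) < n := by exact_mod_cast hn
    have hc : 0 < Real.exp (l / 2) * n := by positivity
    set F : ℝ → ℝ := fun t => ∑ i, invSqrtDist (b i) t with hF
    have hint : IntegrableOn F (Set.Icc 0 x) :=
      integrable_finsetSum _ fun i _ => (intervalIntegrable_iff_integrableOn_Icc_of_le hx).1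
        (intervalIntegrable_invSqrtDist (b i) 0 x)
    have hle : ∫ t in Set.Icc 0 x, F t ≤ n * (4 * x) := by
      rw [integral_Icc_eq_integral_Ioc, ← intervalIntegral.integral_of_le hx, hF,
        intervalIntegral.integral_finsetSum fun i _ => intervalIntegrable_invSqrtDist (b i) 0 x]
      refine (Finset.sum_le_sum fun i _ => integral_invSqrtDist_le (hb i) hx).trans ?_
      simp
    have hmk := mul_meas_ge_le_integral_of_nonneg (μ := volume.restrict (Set.Icc 0 x)) (f := F)
      (ae_of_all _ fun t => Finset.sum_nonneg fun i _ => invSqrtDist_nonneg (hb i).le t) hint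
      (Real.exp (l / 2) * n)
    have hsub : {t | Real.exp (l / 2) * n < F t} ∩ Set.Icc 0 x ⊆
        {t | Real.exp (l / 2) * n ≤ F t} ∩ Set.Icc 0 x :=
      Set.inter_subset_inter_left _ (Set.ofPred_subset_ofPred.2 fun t ht => ht.le)
    refine (measure_mono hsub).trans ?_
    rw [← Measure.restrict_apply' measurableSet_Icc]
    rw [← ENNReal.ofReal_toReal (measure_ne_top (volume.restrict (Set.Icc 0 x))
      {t | Real.exp (l / 2) * n ≤ F t})]
    refine ENNReal.ofReal_le_ofReal ?_
    have h1 : Real.exp (l / 2) * n * (volume.restrict (Set.Icc 0 x)).real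
        {t | Real.exp (l / 2) * n ≤ F t} ≤ n * (4 * x) := hmk.trans hle
    rw [Measure.real] at h1
    have h2 : Real.exp (-(l / 2)) * Real.exp (l / 2) = 1 := by
      rw [← Real.exp_add]; simp
    have h3 := mul_le_mul_of_nonneg_left h1 (Real.exp_pos (-(l / 2))).le
    have h4 : n * ((volume.restrict (Set.Icc 0 x)) {t | Real.exp (l / 2) * n ≤ F t}).toReal ≤
        n * (4 * Real.exp (-(l / 2)) * x) := by
      calc _ = (Real.exp (-(l / 2)) * Real.exp (l / 2)) * (n *
              ((volume.restrict (Set.Icc 0 x)) {t | Real.exp (l / 2) * n ≤ F t}).toReal) := by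
            rw [h2, one_mul]
        _ ≤ _ := by linarith
    exact le_of_mul_le_mul_left h4 hn'
  · simp only [Set.mem_union, Set.mem_range, Set.mem_ofPred_eq, not_or, not_exists, not_lt] at ht
    obtain ⟨ht1, ht2⟩ := ht
    have hne : ∀ i, t ≠ b i := fun i hi => ht1 i hi.symm
    refine ⟨hne, ?_⟩
    have hpos : ∀ i, 0 < |1 - t / b i| := fun i =>
      abs_pos.2 (sub_ne_zero.2 fun h => hne i ((div_eq_one_iff_eq (hb i).ne').1 h.symm))
    have hterm : ∀ i, 1 + (-(Real.log |1 - t / b i| / 2) - l / 2) ≤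
        Real.exp (-(l / 2)) * invSqrtDist (b i) t := by
      intro i
      rw [invSqrtDist_eq (hb i) (hne i), Real.rpow_def_of_pos (hpos i), ← Real.exp_add]
      refine le_trans (le_of_eq (add_comm _ _)) ((Real.add_one_le_exp _).trans (le_of_eq ?_))
      congr 1
      ring
    have hsum := Finset.sum_le_sum fun i (_ : i ∈ Finset.univ) => hterm i
    rw [← Finset.mul_sum, Finset.sum_add_distrib, Finset.sum_sub_distrib, Finset.sum_neg_distrib,
      ← Finset.sum_div] at hsum
    simp only [Finset.sum_const, Finset.card_univ, Fintype.card_fin, nsmul_eq_mul, mul_one] at hsum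
    have h2 : Real.exp (-(l / 2)) * Real.exp (l / 2) = 1 := by
      rw [← Real.exp_add]; simp
    have h3 := mul_le_mul_of_nonneg_left ht2 (Real.exp_pos (-(l / 2))).le
    rw [← mul_assoc, h2, one_mul] at h3
    linarith

/-- Minimum modulus estimate on a disc in which the maximum modulus is controlled. -/
theorem exists_exceptional_radii_lower_bound {g : ℂ → ℂ} (hg : Differentiable ℂ g) (h0 : g 0 = 1)
    {s E ε l : ℝ} (hs : 0 < s) (hE : 0 < E) (hL : ∀ r, r < s → Linf g r ≤ E) (hε : 0 < ε)
    (hε1 : ε < 1) (hl : 0 ≤ l) :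
    ∃ B : Set ℝ, (∀ x, 0 ≤ x →
        volume (B ∩ Set.Icc 0 x) ≤ ENNReal.ofReal ((3 * ε + 4 * Real.exp (-(l / 2))) * x)) ∧
      ∀ z : ℂ, ‖z‖ ≤ s → ‖z‖ ∉ B → -(E / ε * (4 + l)) ≤ Real.log ‖g z‖ := by
  have hp : 0 < 1 - ε := by linarith
  set p := 1 - ε with hpdef
  have hr : 0 < p ^ 2 * s := by positivity
  have hR : 0 < p * s := by positivity
  have hrR : p ^ 2 * s < p * s := by nlinarith
  have hgE : Linf g (p * s) ≤ E := hL _ (by nlinarith)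
  obtain ⟨n, a, h, hh, hfac, ha0, ha, hne⟩ := exists_factor_zeros hg h0 hr
  obtain ⟨B, hB, hB'⟩ := exists_exceptional_radii (fun i => ‖a i‖)
    (fun i => norm_pos_iff.2 (ha0 i)) l
  have hn : n * ε ≤ E := by
    refine le_trans ?_ ((card_zeros_mul_log_le_Linf hg hh h0 hfac hR ha0 ha).trans hgE)
    gcongr
    have e : p * s / (p ^ 2 * s) = p⁻¹ := by field_simp
    rw [e, Real.log_inv]
    have := Real.log_le_sub_one_of_pos hp
    linarith
  refine ⟨Set.Icc (p ^ 3 * s) s ∪ B, fun x hx => ?_, fun z hz hzB => ?_⟩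
  · have hA : volume (Set.Icc (p ^ 3 * s) s ∩ Set.Icc 0 x) ≤ ENNReal.ofReal (3 * ε * x) := by
      rw [Set.Icc_inter_Icc, Real.volume_Icc]
      refine ENNReal.ofReal_le_ofReal ?_
      have hp3 : 1 - p ^ 3 ≤ 3 * ε := by
        rw [hpdef]; nlinarith [pow_pos hε 3, pow_pos hε 2]
      have hp0 : 0 ≤ 1 - p ^ 3 := by
        have : p ^ 3 ≤ 1 := pow_le_one₀ hp.le (by linarith)
        linarith
      have h1 : p ^ 3 * s ≤ p ^ 3 * s ⊔ 0 := le_sup_left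
      rcases le_total s x with hsx | hsx
      · rw [inf_eq_left.2 hsx]
        nlinarith [mul_le_mul_of_nonneg_right hp3 hs.le, mul_le_mul_of_nonneg_left hsx hε.le]
      · rw [inf_eq_right.2 hsx]
        nlinarith [mul_le_mul_of_nonneg_right hp3 hx,
          mul_le_mul_of_nonneg_left hsx (pow_pos hp 3).le]
    rw [Set.union_inter_distrib_right, add_mul, ENNReal.ofReal_add (by positivity) (by positivity)]
    exact (measure_union_le _ _).trans (add_le_add hA (hB x hx))
  · rw [Set.mem_union, not_or, Set.mem_Icc, not_and_or] at hzB
    obtain ⟨hz1, hz2⟩ := hzB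
    have hz3 : ‖z‖ < p ^ 3 * s := by
      rcases hz1 with h | h
      · exact not_le.1 h
      · exact absurd hz h
    have hzr : ‖z‖ < p ^ 2 * s := hz3.trans (by nlinarith [pow_pos hp 2])
    obtain ⟨hza, hsum⟩ := hB' _ hz2
    have key := le_log_norm_of_zeros hg hh h0 hfac ha0 ha hrR.le hne hE hgE hzr hza
    refine le_trans (neg_le_neg ?_) key
    have hd : 0 < p ^ 2 * s - ‖z‖ := by linarith
    have hD : 0 < E / ε := by positivity
    have hEε : E ≤ E / ε := by rw [le_div_iff₀ hε]; nlinarith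
    have hn' : (n : ℝ) ≤ E / ε := by rwa [le_div_iff₀ hε]
    have t1 : 2 * E * ‖z‖ / (p ^ 2 * s - ‖z‖) ≤ 2 * (E / ε) := by
      have : 2 * (E / ε) = 2 * E / ε := by ring
      rw [this, div_le_div_iff₀ hd hε, mul_assoc (2 * E)]
      refine mul_le_mul_of_nonneg_left ?_ (by positivity)
      have : p ^ 3 * s = (1 - ε) * (p ^ 2 * s) := by rw [hpdef]; ring
      nlinarith
    have t2 : n * Real.log 2 ≤ E / ε := by
      have := Real.log_two_lt_d9
      have := Real.log_pos one_lt_two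
      nlinarith
    have t3 : l * n ≤ l * (E / ε) := by gcongr
    linarith

theorem upDens_univ : upDens Set.univ = 1 := by
  refine Tendsto.limsup_eq (tendsto_const_nhds.congr' ?_)
  filter_upwards [eventually_gt_atTop 0] with r hr
  rw [Set.univ_inter, Real.volume_Icc, sub_zero, ENNReal.toReal_ofReal hr.le, div_self hr.ne']

/-- A union of a bounded set and of countably many sets of summable density. -/
theorem upDens_union_lt {δ r₀ : ℝ} (hr₀ : 0 ≤ r₀) {B : ℕ → Set ℝ} {c : ℕ → ℝ}
    (hc0 : ∀ j, 0 ≤ c j) (hc : Summable c) (hcδ : ∑' j, c j < δ)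
    (hB : ∀ j x, 0 ≤ x → volume (B j ∩ Set.Icc 0 x) ≤ ENNReal.ofReal (c j * x)) :
    upDens (Set.Icc 0 r₀ ∪ ⋃ j, B j) < δ := by
  set S := ∑' j, c j with hS
  have hS0 : 0 ≤ S := tsum_nonneg hc0
  obtain ⟨d, hd1, hd2⟩ := exists_between hcδ
  refine lt_of_le_of_lt ?_ hd2
  refine limsup_le_of_le (IsCoboundedUnder.of_frequently_ge (a := 0)
    ((eventually_gt_atTop 0).frequently.mono fun x hx => by positivity)) ?_
  filter_upwards [eventually_gt_atTop 0, eventually_ge_atTop (r₀ / (d - S))] with x hx hx2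
  have hdS : 0 < d - S := by linarith
  rw [div_le_iff₀ hdS] at hx2
  rw [div_le_iff₀ hx]
  refine ENNReal.toReal_le_of_le_ofReal (by nlinarith) ?_
  have h1 : volume (Set.Icc 0 r₀ ∩ Set.Icc 0 x) ≤ ENNReal.ofReal r₀ := by
    refine (measure_mono Set.inter_subset_left).trans ?_
    rw [Real.volume_Icc, sub_zero]
  have h2 : volume ((⋃ j, B j) ∩ Set.Icc 0 x) ≤ ENNReal.ofReal (S * x) := by
    rw [Set.iUnion_inter]
    refine (measure_iUnion_le _).trans ((ENNReal.tsum_le_tsum fun j => hB j x hx.le).trans ?_)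
    rw [← ENNReal.ofReal_tsum_of_nonneg (fun j => mul_nonneg (hc0 j) hx.le) (hc.mul_right x),
      tsum_mul_right]
  rw [Set.union_inter_distrib_right]
  refine (measure_union_le _ _).trans ((add_le_add h1 h2).trans ?_)
  rw [← ENNReal.ofReal_add hr₀ (by positivity)]
  exact ENNReal.ofReal_le_ofReal (by linarith)

/-- The exceptional set attached to the radii at which `log (Linf g r)` lies in `[k, k + 1)`. -/
theorem exists_exceptional_radii_of_level {g : ℂ → ℂ} (hg : TranscEntire g) (h0 : g 0 = 1)
    {q : ℝ} (hq : 1 < q) {k : ℕ} (hk : 2 ≤ k) :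
    ∃ B : Set ℝ, (∀ x, 0 ≤ x → volume (B ∩ Set.Icc 0 x) ≤
        ENNReal.ofReal ((3 * (k : ℝ) ^ (-q) + 4 * (k : ℝ) ^ (-2 : ℝ)) * x)) ∧
      ∀ z : ℂ, Real.exp k ≤ Linf g ‖z‖ → Linf g ‖z‖ ≤ Real.exp (k + 1) → ‖z‖ ∉ B →
        -(Real.exp (k + 1) * (k : ℝ) ^ q * (4 + 4 * Real.log k)) ≤ Real.log ‖g z‖ := by
  have hk1 : (1 : ℝ) < k := by exact_mod_cast hk
  have hk0 : (0 : ℝ) < k := by linarith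
  set T : Set ℝ := {r | Linf g r ≤ Real.exp (k + 1)} with hT
  have hbdd : BddAbove T := by
    obtain ⟨b, hb⟩ := (tendsto_atTop_atTop.1 (tendsto_Linf_atTop hg)) (Real.exp (k + 1) + 1)
    exact ⟨b, fun r hr => le_of_not_ge fun h => by
      have := hb r h; have : Linf g r ≤ Real.exp (k + 1) := hr; linarith⟩
  have hlt : ∀ r, r < sSup T → Linf g r ≤ Real.exp (k + 1) := by
    intro r hr
    by_cases hne : T.Nonempty
    · obtain ⟨r', hr', hrr'⟩ := exists_lt_of_lt_csSup hne hr
      exact (Linf_mono hg.1 hrr'.le).trans hr'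
    · exfalso
      refine hne ⟨-1, ?_⟩
      have : Linf g (-1) = 0 := by
        rw [Linf, sphere_eq_empty_of_neg (by norm_num)]; simp
      rw [hT, Set.mem_ofPred_eq, this]
      positivity
  by_cases hs : 0 < sSup T
  · obtain ⟨B, hB, hB'⟩ := exists_exceptional_radii_lower_bound hg.1 h0 (s := sSup T)
      (E := Real.exp (k + 1)) (ε := (k : ℝ) ^ (-q)) (l := 4 * Real.log k) hs (Real.exp_pos _) hlt
      (by positivity) (Real.rpow_lt_one_of_one_lt_of_neg hk1 (by linarith))
      (mul_nonneg (by norm_num) (Real.log_nonneg hk1.le))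
    refine ⟨B, fun x hx => (hB x hx).trans_eq ?_, fun z _ hz2 hzB => ?_⟩
    · rw [Real.rpow_def_of_pos hk0 (-2)]
      ring_nf
    · have := hB' z (le_csSup hbdd hz2) hzB
      rwa [Real.rpow_neg hk0.le, div_inv_eq_mul] at this
  · refine ⟨∅, fun x hx => by simp, fun z hz1 hz2 _ => ?_⟩
    exfalso
    have hz0 : ‖z‖ ≤ 0 := (le_csSup hbdd hz2).trans (not_lt.1 hs)
    have hz : z = 0 := norm_le_zero_iff.1 hz0
    have : Linf g ‖z‖ = 0 := by
      subst hz
      rw [Linf, norm_zero, sphere_zero]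
      simp [h0, logPlus]
    rw [this] at hz1
    exact absurd hz1 (not_le.2 (Real.exp_pos _))

/-- The minimum modulus estimate outside a set of arbitrarily small upper density. -/
theorem minimum_modulus_of_small_density {g : ℂ → ℂ} (hg : TranscEntire g) (h0 : g 0 = 1)
    {δ m : ℝ} (hδ : 0 < δ) (hm : 1 < m) :
    ∃ C : ℝ, 0 < C ∧ ∃ F : Set ℝ, upDens F < δ ∧ ∀ z : ℂ, ‖z‖ ∉ F →
      0 ≤ Linf g ‖z‖ * Real.log (Linf g ‖z‖) ^ m ∧
      -(C * (Linf g ‖z‖ * Real.log (Linf g ‖z‖) ^ m)) ≤ Real.log ‖g z‖ := by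
  set q := (1 + m) / 2 with hq
  set η := m - q with hη
  have hq1 : 1 < q := by linarith
  have hη0 : 0 < η := by linarith
  set c : ℕ → ℝ := fun k => 3 * (k : ℝ) ^ (-q) + 4 * (k : ℝ) ^ (-2 : ℝ) with hc
  have hcs : Summable c := by
    refine Summable.add (Summable.mul_left _ ?_) (Summable.mul_left _ ?_)
    · exact Real.summable_nat_rpow.2 (by linarith)
    · exact Real.summable_nat_rpow.2 (by norm_num)
  obtain ⟨K, hK, hK2⟩ := (((tendsto_sum_nat_add c).eventually_lt_const hδ).and
    (eventually_ge_atTop 2)).exists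
  choose B hB hB' using fun j : ℕ =>
    exists_exceptional_radii_of_level hg h0 hq1 (k := j + K) (by omega)
  obtain ⟨r₁, hr₁⟩ := tendsto_atTop_atTop.1 (tendsto_Linf_atTop hg) (Real.exp K)
  refine ⟨Real.exp 1 * (4 + 4 / η), by positivity, Set.Icc 0 (max r₁ 0) ∪ ⋃ j, B j,
    upDens_union_lt (le_max_right _ _) (c := fun j => c (j + K)) (fun j => by positivity)
      ((summable_nat_add_iff K).2 hcs) hK (fun j x hx => hB j x hx), fun z hz => ?_⟩
  simp only [Set.mem_union, Set.mem_Icc, norm_nonneg, true_and, Set.mem_iUnion, not_or,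
    not_exists, not_le] at hz
  obtain ⟨hz1, hz2⟩ := hz
  have hL := hr₁ ‖z‖ ((le_max_left _ _).trans hz1.le)
  set L := Linf g ‖z‖ with hLdef
  have hLpos : 0 < L := (Real.exp_pos _).trans_le hL
  have hKl : (K : ℝ) ≤ Real.log L := (Real.le_log_iff_exp_le hLpos).2 hL
  have hK2' : (2 : ℝ) ≤ K := by exact_mod_cast hK2
  have hl0 : 0 ≤ Real.log L := by linarith
  refine ⟨mul_nonneg hLpos.le (Real.rpow_nonneg hl0 _), ?_⟩
  set k := ⌊Real.log L⌋₊ with hk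
  have hk1 : (k : ℝ) ≤ Real.log L := Nat.floor_le hl0
  have hk2 : Real.log L < k + 1 := Nat.lt_floor_add_one _
  have hKk : K ≤ k := Nat.le_floor hKl
  have hkpos : (0 : ℝ) < k := by
    have : (K : ℝ) ≤ k := by exact_mod_cast hKk
    linarith
  have key := hB' (k - K) z
  rw [Nat.sub_add_cancel hKk] at key
  have hek : Real.exp k ≤ L := (Real.le_log_iff_exp_le hLpos).1 hk1
  refine le_trans (neg_le_neg ?_)
    (key hek ((Real.log_le_iff_le_exp hLpos).1 hk2.le) (hz2 _))
  have hkη : 1 ≤ (k : ℝ) ^ η :=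
    Real.one_le_rpow (by linarith [show (K : ℝ) ≤ k by exact_mod_cast hKk]) hη0.le
  have hlog : 4 + 4 * Real.log k ≤ (4 + 4 / η) * (k : ℝ) ^ η := by
    have := Real.log_le_rpow_div hkpos.le hη0
    have e : 4 / η * (k : ℝ) ^ η = 4 * ((k : ℝ) ^ η / η) := by ring
    rw [add_mul, e]
    linarith
  calc Real.exp (k + 1) * (k : ℝ) ^ q * (4 + 4 * Real.log k)
      ≤ Real.exp (k + 1) * (k : ℝ) ^ q * ((4 + 4 / η) * (k : ℝ) ^ η) := by gcongr
    _ = Real.exp 1 * (4 + 4 / η) * (Real.exp k * (k : ℝ) ^ m) := by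
        rw [Real.exp_add, show m = q + η by ring, Real.rpow_add hkpos]; ring
    _ ≤ Real.exp 1 * (4 + 4 / η) * (L * Real.log L ^ m) := by gcongr

/-- Lemma 4.3, minimum modulus: for a transcendental entire `g` with
`g(0) = 1`, `δ > 0` and `m > 1`, there is a set `F` of upper linear density `< δ` with
`log|g(z)| ≥ −C(1 + log(1/δ)) L(r,∞,g) logᵐ L(r,∞,g)` for `|z| = r ∉ F`. -/
theorem minimum_modulus_estimate
    (g : ℂ → ℂ) (hg : TranscEntire g) (h0 : g 0 = 1)
    (δ m : ℝ) (hδ : 0 < δ) (hm : 1 < m) :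
    ∃ C : ℝ, 0 < C ∧ ∃ F : Set ℝ, upDens F < δ ∧
      ∀ z : ℂ, ‖z‖ ∉ F →
        -(C * (1 + Real.log (1 / δ)) * Linf g ‖z‖ * Real.log (Linf g ‖z‖) ^ m)
          ≤ Real.log ‖g z‖ := by
  rcases le_or_gt δ 1 with h1 | h1
  · obtain ⟨C, hC, F, hF, hbound⟩ := minimum_modulus_of_small_density hg h0 hδ hm
    refine ⟨C, hC, F, hF, fun z hz => le_trans (neg_le_neg ?_) (hbound z hz).2⟩
    have hlog : 0 ≤ Real.log (1 / δ) := Real.log_nonneg ((one_le_div hδ).2 h1)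
    have := mul_nonneg (mul_nonneg hC.le hlog) (hbound z hz).1
    linarith
  · exact ⟨1, one_pos, Set.univ, by rwa [upDens_univ], fun z hz => absurd (Set.mem_univ _) hz⟩
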